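/- There exist compact Hausdorff topological spaces K and L and a continuous surjection π : K → L such that K is weakly Radon–Nikodým but L is not weakly Radon–Nikodým. In particular, the class of weakly Radon–Nikodým compact spaces is not stable under continuous images. -/

import Mathlib

open Set Function

/-- A real Banach space `X` *contains an isomorphic copy of `ℓ¹`* if there is a bounded
linear map from `ℓ¹` into `X` which is an isomorphism onto its image, i.e. bounded below. -/
def ContainsL1 (X : Type*) [NormedAddCommGroup X] [NormedSpace ℝ X] : Prop :=
  ∃ T : lp (fun _ : ℕ => ℝ) 1 →L[ℝ] X, ∃ c : ℝ, 0 < c ∧ ∀ v, c * ‖v‖ ≤ ‖T v‖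

/-- A compact (Hausdorff) space is *weakly Radon–Nikodým* if it is homeomorphic to a
weak*-compact subset of the dual of a real Banach space not containing a copy of `ℓ¹`. -/
def IsWRN (K : Type*) [TopologicalSpace K] : Prop :=
  ∃ (X : Type) (_ : NormedAddCommGroup X) (_ : NormedSpace ℝ X) (_ : CompleteSpace X)
    (S : Set (WeakDual ℝ X)), ¬ ContainsL1 X ∧ IsCompact S ∧ Nonempty (K ≃ₜ S)


/-- The seminorm `‖J ·‖`. -/
noncomputable def normComp {V E : Type*} [AddCommGroup V] [Module ℝ V] [NormedAddCommGroup E]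
    [NormedSpace ℝ E] (J : V →ₗ[ℝ] E) : Seminorm ℝ V := (normSeminorm ℝ E).comp J

/-- The gauge of `2ⁿ B₁ + 2⁻ⁿ B_J`, where `B₁`, `B_J` are the unit balls of `p₁` and `‖J ·‖`. -/
noncomputable def interp {V E : Type*} [AddCommGroup V] [Module ℝ V] [NormedAddCommGroup E]
    [NormedSpace ℝ E] (J : V →ₗ[ℝ] E) (p₁ : Seminorm ℝ V) (n : ℕ) : Seminorm ℝ V :=
  (((2 : NNReal)⁻¹ ^ n) • p₁) ⊓ (((2 : NNReal) ^ n) • normComp J)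

section Interp

variable {V E : Type*} [AddCommGroup V] [Module ℝ V] [NormedAddCommGroup E] [NormedSpace ℝ E]
  {J : V →ₗ[ℝ] E} {p₁ : Seminorm ℝ V}

lemma interp_le_left (n : ℕ) (v : V) : interp J p₁ n v ≤ 2⁻¹ ^ n * p₁ v := by
  have h : interp J p₁ n ≤ ((2 : NNReal)⁻¹ ^ n) • p₁ := inf_le_left
  have := h v
  simpa [NNReal.smul_def] using this

lemma interp_le_right (n : ℕ) (v : V) : interp J p₁ n v ≤ 2 ^ n * ‖J v‖ := by
  have h : interp J p₁ n ≤ ((2 : NNReal) ^ n) • normComp J := inf_le_right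
  have := h v
  simpa [NNReal.smul_def, normComp] using this

lemma exists_of_interp_lt {n : ℕ} {v : V} {a : ℝ} (h : interp J p₁ n v < a) :
    ∃ u, 2⁻¹ ^ n * p₁ u + 2 ^ n * ‖J (v - u)‖ < a := by
  rw [interp, Seminorm.inf_apply] at h
  obtain ⟨u, hu⟩ := exists_lt_of_ciInf_lt h
  exact ⟨u, by simpa [NNReal.smul_def, normComp] using hu⟩

lemma norm_le_interp_zero (hJ : ∀ v, ‖J v‖ ≤ p₁ v) (v : V) : ‖J v‖ ≤ interp J p₁ 0 v := by
  by_contra! h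
  obtain ⟨u, hu⟩ := exists_of_interp_lt h
  have h1 : ‖J v‖ ≤ ‖J u‖ + ‖J (v - u)‖ := by
    have := norm_add_le (J u) (J (v - u))
    rwa [← map_add, add_sub_cancel] at this
  have := hJ u
  simp only [pow_zero, one_mul] at hu
  linarith

lemma interp_bddAbove : BddAbove (range (interp J p₁)) := by
  rw [Seminorm.bddAbove_range_iff]
  intro v
  refine ⟨p₁ v, ?_⟩
  rintro _ ⟨n, rfl⟩
  refine (interp_le_left n v).trans ?_
  exact mul_le_of_le_one_left (apply_nonneg _ _) (pow_le_one₀ (by norm_num) (by norm_num))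

/-- The Davis–Figiel–Johnson–Pełczyński type (`c₀`-sum) interpolation seminorm. -/
noncomputable def interpSup (J : V →ₗ[ℝ] E) (p₁ : Seminorm ℝ V) : Seminorm ℝ V := ⨆ n, interp J p₁ n

lemma interp_le_interpSup (n : ℕ) (v : V) : interp J p₁ n v ≤ interpSup J p₁ v :=
  (le_ciSup interp_bddAbove n : interp J p₁ n ≤ interpSup J p₁) v

lemma interpSup_le {v : V} {a : ℝ} (h : ∀ n, interp J p₁ n v ≤ a) : interpSup J p₁ v ≤ a := by
  rw [interpSup, Seminorm.iSup_apply interp_bddAbove]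
  exact ciSup_le h

/-- A quantitative averaging property of the map `J` on the unit ball of `p₁`: suitable signed
averages of any `N` elements have small image. -/
def SignAveraging (J : V →ₗ[ℝ] E) (p₁ : Seminorm ℝ V) : Prop :=
  ∀ δ > 0, ∃ N : ℕ, 0 < N ∧ ∀ a : ℕ → V, (∀ i, p₁ (a i) ≤ 1) →
    ∃ ε : ℕ → ℝ, (∀ i, |ε i| = 1) ∧ ‖J (∑ i ∈ Finset.range N, ε i • a i)‖ ≤ δ * N

lemma exists_block (hs : SignAveraging J p₁) {v : ℕ → V} {C : ℝ}
    (hv : ∀ i, interpSup J p₁ (v i) ≤ C) {δ : ℝ} (hδ : 0 < δ) :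
    ∃ N : ℕ, ∃ b : ℕ → ℝ, ∑ i ∈ Finset.range N, |b i| = 1 ∧
      ‖J (∑ i ∈ Finset.range N, b i • v i)‖ ≤ δ := by
  have hC : 0 ≤ C := (apply_nonneg _ _).trans (hv 0)
  obtain ⟨n, hn⟩ := pow_unbounded_of_one_lt (2 * (C + 1) / δ) (one_lt_two)
  have hn0 : (0 : ℝ) < 2 ^ n := by positivity
  have hn' : C + 1 ≤ 2 ^ n * (δ / 2) := by
    rw [div_lt_iff₀ hδ] at hn; linarith
  have hdec : ∀ i, ∃ u, 2⁻¹ ^ n * p₁ u + 2 ^ n * ‖J (v i - u)‖ < C + 1 := fun i =>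
    exists_of_interp_lt (((interp_le_interpSup n _).trans (hv i)).trans_lt (by linarith))
  choose a ha using hdec
  have hp : ∀ i, p₁ (a i) ≤ 2 ^ n * (C + 1) := by
    intro i
    have h1 : 2⁻¹ ^ n * p₁ (a i) ≤ C + 1 := by
      have := ha i
      have : 0 ≤ 2 ^ n * ‖J (v i - a i)‖ := by positivity
      linarith
    rw [inv_pow, inv_mul_le_iff₀ hn0] at h1
    exact h1
  have hr : ∀ i, ‖J (v i - a i)‖ ≤ δ / 2 := by
    intro i
    have h1 : 2 ^ n * ‖J (v i - a i)‖ ≤ 2 ^ n * (δ / 2) := by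
      have := ha i
      have : 0 ≤ 2⁻¹ ^ n * p₁ (a i) := by positivity
      linarith
    exact le_of_mul_le_mul_left h1 hn0
  set D := 2 ^ n * (C + 1) with hD
  have hD0 : 0 < D := by positivity
  obtain ⟨N, hN, h⟩ := hs (δ / (2 * D)) (by positivity)
  obtain ⟨ε, hε, hb⟩ := h (fun i => D⁻¹ • a i) (fun i => by
    rw [map_smul_eq_mul, norm_inv, Real.norm_of_nonneg hD0.le, inv_mul_le_iff₀ hD0, mul_one]
    exact hp i)
  have hN0 : (0 : ℝ) < N := by exact_mod_cast hN
  refine ⟨N, fun i => ε i / N, ?_, ?_⟩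
  · simp only [abs_div, hε, Nat.abs_cast]
    simp [hN0.ne']
  · have e1 : ∑ i ∈ Finset.range N, (ε i / N) • v i =
        (D / N) • (∑ i ∈ Finset.range N, ε i • D⁻¹ • a i) +
          ∑ i ∈ Finset.range N, (ε i / N) • (v i - a i) := by
      rw [Finset.smul_sum, ← Finset.sum_add_distrib]
      refine Finset.sum_congr rfl fun i _ => ?_
      rw [smul_smul, smul_smul, smul_sub]
      have : D / N * (ε i * D⁻¹) = ε i / N := by field_simp
      rw [← mul_assoc] at this
      rw [this, add_sub_cancel]
    rw [e1, map_add, map_smul]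
    refine (norm_add_le _ _).trans ?_
    have h1 : ‖(D / N) • J (∑ i ∈ Finset.range N, ε i • D⁻¹ • a i)‖ ≤ δ / 2 := by
      rw [norm_smul, Real.norm_of_nonneg (by positivity)]
      calc _ ≤ D / N * (δ / (2 * D) * N) := by gcongr
        _ = δ / 2 := by field_simp
    have h2 : ‖J (∑ i ∈ Finset.range N, (ε i / N) • (v i - a i))‖ ≤ δ / 2 := by
      rw [map_sum]
      refine (norm_sum_le _ _).trans ?_
      calc _ ≤ ∑ i ∈ Finset.range N, (1 / N : ℝ) * (δ / 2) := by
            refine Finset.sum_le_sum fun i _ => ?_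
            rw [map_smul, norm_smul, norm_div, Real.norm_eq_abs, hε, Real.norm_natCast]
            gcongr
            exact hr i
        _ = δ / 2 := by simp; field_simp
    linarith

lemma exists_flat_combination (hs : SignAveraging J p₁) {v : ℕ → V} {C : ℝ}
    (hv : ∀ i, interpSup J p₁ (v i) ≤ C) {δ : ℝ} (hδ : 0 < δ) (M : ℕ) :
    ∃ m : ℕ, ∃ b : ℕ → ℝ, ∑ i ∈ Finset.range m, |b i| = M ∧
      interpSup J p₁ (∑ i ∈ Finset.range m, b i • v i) ≤ C + M * δ := by
  have hC : 0 ≤ C := (apply_nonneg _ _).trans (hv 0)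
  induction M with
  | zero => exact ⟨0, 0, by simp, by simpa using hC⟩
  | succ M ih =>
    obtain ⟨m, b, hb, hU⟩ := ih
    set U := ∑ i ∈ Finset.range m, b i • v i with hUdef
    obtain ⟨n₀, hn₀⟩ : ∃ n₀ : ℕ, ∀ n ≥ n₀, interp J p₁ n U ≤ δ := by
      have ht : Filter.Tendsto (fun n : ℕ => (2⁻¹ : ℝ) ^ n * p₁ U) Filter.atTop (nhds 0) := by
        simpa using (tendsto_pow_atTop_nhds_zero_of_lt_one (r := (2⁻¹ : ℝ)) (by norm_num)
          (by norm_num)).mul_const (p₁ U)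
      obtain ⟨n₀, h⟩ := Filter.eventually_atTop.1 (ht.eventually (ge_mem_nhds hδ))
      exact ⟨n₀, fun n hn => (interp_le_left n U).trans (h n hn)⟩
    obtain ⟨N, b', hb', hs'⟩ := exists_block hs (v := fun i => v (m + i)) (fun i => hv _)
      (δ := δ / 2 ^ n₀) (by positivity)
    set u := ∑ i ∈ Finset.range N, b' i • v (m + i) with hudef
    have hu : interpSup J p₁ u ≤ C := by
      calc interpSup J p₁ u ≤ ∑ i ∈ Finset.range N, interpSup J p₁ (b' i • v (m + i)) :=
            Finset.le_sum_of_subadditive _ (map_zero _).le (map_add_le_add _) _ _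
        _ ≤ ∑ i ∈ Finset.range N, |b' i| * C := by
            refine Finset.sum_le_sum fun i _ => ?_
            rw [map_smul_eq_mul, Real.norm_eq_abs]
            exact mul_le_mul_of_nonneg_left (hv _) (abs_nonneg _)
        _ = C := by rw [← Finset.sum_mul, hb', one_mul]
    refine ⟨m + N, fun i => if i < m then b i else b' (i - m), ?_, ?_⟩
    · rw [Finset.sum_range_add]
      push_cast
      congr 1
      · rw [← hb]
        exact Finset.sum_congr rfl fun i hi => by simp [Finset.mem_range.1 hi]
      · rw [← hb']
        exact Finset.sum_congr rfl fun i hi => by simp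
    · have e : ∑ i ∈ Finset.range (m + N), (if i < m then b i else b' (i - m)) • v i = U + u := by
        rw [Finset.sum_range_add]
        congr 1
        · exact Finset.sum_congr rfl fun i hi => by simp [Finset.mem_range.1 hi]
        · exact Finset.sum_congr rfl fun i hi => by simp
      rw [e]
      refine interpSup_le fun n => ?_
      refine (map_add_le_add _ _ _).trans ?_
      push_cast
      have hMδ : 0 ≤ M * δ := by positivity
      rcases lt_or_ge n n₀ with h | h
      · have h1 : interp J p₁ n u ≤ δ := by
          refine (interp_le_right n u).trans ?_
          calc (2 : ℝ) ^ n * ‖J u‖ ≤ 2 ^ n₀ * (δ / 2 ^ n₀) := by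
                gcongr
                · norm_num
            _ = δ := by field_simp
        have := (interp_le_interpSup n U).trans hU
        linarith
      · have := hn₀ n h
        have := (interp_le_interpSup n u).trans hu
        linarith

theorem not_l1_lower_bound (hs : SignAveraging J p₁) {v : ℕ → V} {C c : ℝ} (hc : 0 < c)
    (hv : ∀ i, interpSup J p₁ (v i) ≤ C) :
    ¬ ∀ (m : ℕ) (b : ℕ → ℝ), c * ∑ i ∈ Finset.range m, |b i| ≤
      interpSup J p₁ (∑ i ∈ Finset.range m, b i • v i) := by
  intro h
  obtain ⟨M, hM⟩ := exists_nat_gt (2 * C / c)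
  obtain ⟨m, b, hb, hU⟩ := exists_flat_combination hs hv (δ := c / 2) (by positivity) M
  have := h m b
  rw [hb] at this
  rw [div_lt_iff₀ hc] at hM
  linarith

end Interp

/-- Interpolation: a linear map with the sign averaging property factors, on a dense subspace,
through a Banach space without `ℓ¹`. -/
theorem exists_factor_not_containsL1 {V E : Type} [AddCommGroup V] [Module ℝ V]
    [NormedAddCommGroup E] [NormedSpace ℝ E] [CompleteSpace E]
    {J : V →ₗ[ℝ] E} {p₁ : Seminorm ℝ V} (hJ : ∀ v, ‖J v‖ ≤ p₁ v) (hs : SignAveraging J p₁) :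
    ∃ (X : Type) (_ : NormedAddCommGroup X) (_ : NormedSpace ℝ X) (_ : CompleteSpace X)
      (j : X →L[ℝ] E), ¬ ContainsL1 X ∧ ∀ v, ∃ x, j x = J v := by
  let iG : SeminormedAddCommGroup V := (interpSup J p₁).toAddGroupSeminorm.toSeminormedAddCommGroup
  have hnorm : ∀ v : V, ‖v‖ = interpSup J p₁ v := fun v => rfl
  let iS : NormedSpace ℝ V :=
    { norm_smul_le := fun a v => by rw [hnorm, hnorm, map_smul_eq_mul] }
  let J₀ : V →L[ℝ] E := J.mkContinuous 1 (fun v => by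
    rw [one_mul, hnorm]
    exact (norm_le_interp_zero hJ v).trans (interp_le_interpSup 0 v))
  let X := UniformSpace.Completion V
  let ι : V →L[ℝ] X := UniformSpace.Completion.toComplL
  have hι : ∀ v, ‖ι v‖ = interpSup J p₁ v := fun v => UniformSpace.Completion.norm_coe v
  have hdense : DenseRange ι := UniformSpace.Completion.denseRange_coe
  have hui : IsUniformInducing ι := UniformSpace.Completion.isUniformInducing_coe V
  refine ⟨X, inferInstance, inferInstance, inferInstance, J₀.extend ι, ?_, fun v =>
    ⟨ι v, J₀.extend_eq hdense hui v⟩⟩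
  rintro ⟨T, c, hc, hT⟩
  let e : ℕ → lp (fun _ : ℕ => ℝ) 1 := fun i => lp.single 1 i (1 : ℝ)
  have he : ∀ i, ‖e i‖ = 1 := fun i => by
    simp [e]
  have hesum : ∀ (m : ℕ) (b : ℕ → ℝ), ‖∑ i ∈ Finset.range m, b i • e i‖ =
      ∑ i ∈ Finset.range m, |b i| := by
    intro m b
    have := lp.norm_sum_single (E := fun _ : ℕ => ℝ) (p := 1) (by simp) b (Finset.range m)
    simp only [ENNReal.toReal_one, Real.rpow_one, Real.norm_eq_abs] at this
    rw [← this]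
    congr 1
    refine Finset.sum_congr rfl fun i _ => ?_
    rw [← lp.single_smul]; simp
  have happ : ∀ i, ∃ v : V, ‖T (e i) - ι v‖ < c / 2 := fun i => by
    obtain ⟨v, hv⟩ := hdense.exists_dist_lt (T (e i)) (half_pos hc)
    exact ⟨v, by rwa [← dist_eq_norm]⟩
  choose v hv using happ
  refine not_l1_lower_bound hs (v := v) (C := ‖T‖ + c / 2) (half_pos hc) (fun i => ?_)
    (fun m b => ?_)
  · rw [← hι]
    have h1 : ‖T (e i)‖ ≤ ‖T‖ := by
      have := T.le_opNorm (e i); rwa [he, mul_one] at this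
    have h2 := norm_sub_norm_le (ι (v i)) (T (e i))
    rw [norm_sub_rev] at h2
    have := hv i
    linarith
  · rw [← hι, map_sum]
    have h1 := hT (∑ i ∈ Finset.range m, b i • e i)
    rw [hesum, map_sum] at h1
    have h2 : ‖∑ i ∈ Finset.range m, T (b i • e i) - ∑ i ∈ Finset.range m, ι (b i • v i)‖ ≤
        ∑ i ∈ Finset.range m, |b i| * (c / 2) := by
      rw [← Finset.sum_sub_distrib]
      refine norm_sum_le_of_le _ fun i _ => ?_
      rw [map_smul, map_smul, ← smul_sub, norm_smul, Real.norm_eq_abs]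
      exact mul_le_mul_of_nonneg_left (hv i).le (abs_nonneg _)
    rw [← Finset.sum_mul] at h2
    have h3 := norm_sub_norm_le (∑ i ∈ Finset.range m, T (b i • e i))
      (∑ i ∈ Finset.range m, ι (b i • v i))
    linarith

/-- The sign attached to a Boolean. -/
def boolSign (b : Bool) : ℝ := if b then 1 else -1

lemma abs_boolSign (b : Bool) : |boolSign b| = 1 := by cases b <;> simp [boolSign]

lemma sum_exp_signs_le (N : ℕ) (δ : ℝ) (d : Fin N → ℝ) (hd : ∀ i, |d i| ≤ 1) :
    ∑ ε : Fin N → Bool, Real.exp (δ * ∑ i, boolSign (ε i) * d i) ≤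
      2 ^ N * Real.exp (δ ^ 2 / 2 * N) := by
  have h1 : ∀ ε : Fin N → Bool, Real.exp (δ * ∑ i, boolSign (ε i) * d i) =
      ∏ i, Real.exp (δ * (boolSign (ε i) * d i)) := fun ε => by
    rw [Finset.mul_sum, Real.exp_sum]
  have h2 : ∑ ε : Fin N → Bool, ∏ i, Real.exp (δ * (boolSign (ε i) * d i)) =
      ∏ i, ∑ b : Bool, Real.exp (δ * (boolSign b * d i)) := by
    rw [Finset.prod_univ_sum, Fintype.piFinset_univ]
  simp_rw [h1]
  rw [h2]
  calc _ ≤ ∏ _i : Fin N, 2 * Real.exp (δ ^ 2 / 2) := by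
        refine Finset.prod_le_prod (fun i _ => by positivity) fun i _ => ?_
        have h3 := Real.cosh_le_exp_half_sq (δ * d i)
        have h4 : Real.exp ((δ * d i) ^ 2 / 2) ≤ Real.exp (δ ^ 2 / 2) := by
          refine Real.exp_le_exp.2 ?_
          have : (d i) ^ 2 ≤ 1 := by rw [sq_le_one_iff_abs_le_one]; exact hd i
          rw [mul_pow]
          nlinarith [sq_nonneg δ]
        rw [Real.cosh_eq] at h3
        simp only [Fintype.sum_bool, boolSign, if_true, one_mul]
        simp only [Bool.false_eq_true, if_false, neg_mul, one_mul, mul_neg]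
        linarith
    _ = 2 ^ N * Real.exp (δ ^ 2 / 2 * N) := by
        rw [Finset.prod_const, Finset.card_univ, Fintype.card_fin, mul_pow, ← Real.exp_nat_mul]
        ring_nf

lemma abs_le_of_exp {x δ N : ℝ} (hδ : 0 < δ) (hN : 0 ≤ N) (hx : |x| ≤ N) :
    |x| ≤ δ * N + N * Real.exp (-(δ ^ 2 * N)) * (Real.exp (δ * x) + Real.exp (-δ * x)) := by
  have p1 := Real.exp_pos (δ * x)
  have p2 := Real.exp_pos (-δ * x)
  rcases le_or_gt |x| (δ * N) with h | h
  · have : 0 ≤ N * Real.exp (-(δ ^ 2 * N)) * (Real.exp (δ * x) + Real.exp (-δ * x)) := by positivity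
    linarith
  · have h1 : Real.exp (δ ^ 2 * N) ≤ Real.exp (δ * x) + Real.exp (-δ * x) := by
      have h2 : Real.exp (δ ^ 2 * N) ≤ Real.exp (δ * |x|) := Real.exp_le_exp.2 (by nlinarith)
      rcases abs_cases x with ⟨e, -⟩ | ⟨e, -⟩ <;> rw [e] at h2
      · linarith
      · rw [mul_neg, ← neg_mul] at h2; linarith
    have h3 : N ≤ N * Real.exp (-(δ ^ 2 * N)) * (Real.exp (δ * x) + Real.exp (-δ * x)) := by
      calc N = N * Real.exp (-(δ ^ 2 * N)) * Real.exp (δ ^ 2 * N) := by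
            rw [mul_assoc, ← Real.exp_add]; simp
        _ ≤ _ := by gcongr
    have : 0 ≤ δ * N := by positivity
    linarith

lemma card_le_of_not_shatters {N : ℕ} (𝒜 : Finset (Finset (Fin N)))
    (h : ∀ s : Finset (Fin N), s.card = 3 → ¬ 𝒜.Shatters s) : 𝒜.card ≤ (N + 1) ^ 2 := by
  have hvc : 𝒜.vcDim ≤ 2 := by
    refine Finset.sup_le fun s hs => ?_
    by_contra! hcard
    obtain ⟨t, hts, ht⟩ := Finset.exists_subset_card_eq (s := s) (n := 3) hcard
    exact h t ht ((Finset.mem_shatterer.1 hs).mono_right hts)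
  refine (𝒜.card_le_card_shatterer.trans Finset.card_shatterer_le_sum_vcDim).trans ?_
  calc _ ≤ ∑ k ∈ Finset.Iic 2, (Fintype.card (Fin N)).choose k :=
        Finset.sum_le_sum_of_subset (Finset.Iic_subset_Iic.2 hvc)
    _ = 1 + N + N.choose 2 := by
        rw [show Finset.Iic 2 = {0, 1, 2} from rfl]
        simp; ring
    _ ≤ 1 + N + N ^ 2 := by gcongr; exact Nat.choose_le_pow N 2
    _ ≤ _ := by nlinarith

section Clopen

variable {K Γ : Type*}

/-- No three members of the family `P` lying in one class are independent. -/
def NoIndependentTriple (P : Γ → K → Prop) (cls : Γ → ℕ) : Prop :=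
  ∀ a b c, cls a = cls b → cls b = cls c →
    ¬ ∀ p q r : Prop, ∃ t, (P a t ↔ p) ∧ (P b t ↔ q) ∧ (P c t ↔ r)

open Classical in
/-- The traces on the index set of the members of class `n`. -/
noncomputable def traces (P : Γ → K → Prop) (cls : Γ → ℕ) {N : ℕ} (γ : Fin N → Γ) (n : ℕ) :
    Finset (Finset (Fin N)) :=
  {A | ∃ t, A = ({i | cls (γ i) = n ∧ P (γ i) t} : Finset (Fin N))}

lemma card_traces_le {P : Γ → K → Prop} {cls : Γ → ℕ} (h : NoIndependentTriple P cls) {N : ℕ}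
    (γ : Fin N → Γ) (n : ℕ) : (traces P cls γ n).card ≤ (N + 1) ^ 2 := by
  classical
  refine card_le_of_not_shatters _ fun s hs hsh => ?_
  obtain ⟨a, b, c, hab, hac, hbc, rfl⟩ := Finset.card_eq_three.1 hs
  have key : ∀ t ⊆ ({a, b, c} : Finset (Fin N)), ∃ x, ∀ i ∈ ({a, b, c} : Finset (Fin N)),
      (cls (γ i) = n ∧ P (γ i) x) ↔ i ∈ t := by
    intro t ht
    obtain ⟨u, hu, hut⟩ := hsh ht
    simp only [traces, Finset.mem_filter, Finset.mem_univ, true_and] at hu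
    obtain ⟨x, rfl⟩ := hu
    refine ⟨x, fun i hi => ?_⟩
    rw [← hut]
    simp only [Finset.mem_inter, hi, true_and, Finset.mem_filter, Finset.mem_univ]
  obtain ⟨x₀, hx₀⟩ := key _ subset_rfl
  have hcls : ∀ i ∈ ({a, b, c} : Finset (Fin N)), cls (γ i) = n := fun i hi =>
    ((hx₀ i hi).2 hi).1
  have ha := hcls a (by simp)
  have hb := hcls b (by simp)
  have hc := hcls c (by simp)
  refine h (γ a) (γ b) (γ c) (by rw [ha, hb]) (by rw [hb, hc]) fun p q r => ?_
  obtain ⟨x, hx⟩ := key (({a, b, c} : Finset (Fin N)).filter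
    fun i => (i = a ∧ p) ∨ (i = b ∧ q) ∨ (i = c ∧ r)) (Finset.filter_subset _ _)
  refine ⟨x, ?_, ?_, ?_⟩
  · have := hx a (by simp)
    simpa [ha, hab, hac] using this
  · have := hx b (by simp)
    simpa [hb, hab.symm, hbc] using this
  · have := hx c (by simp)
    simpa [hc, hbc.symm, hac.symm] using this

variable [TopologicalSpace K] [CompactSpace K]

open Classical in
/-- The weighted indicator function of a clopen set. -/
noncomputable def weightedIndicator (P : Γ → K → Prop) (hP : ∀ γ, IsClopen {t | P γ t})
    (cls : Γ → ℕ) (γ : Γ) : C(K, ℝ) where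
  toFun t := if P γ t then 2⁻¹ ^ cls γ else 0
  continuous_toFun := by
    refine continuous_const.if (fun a ha => ?_) continuous_const
    rw [(hP γ).frontier_eq] at ha
    exact ha.elim

/-- The sum, over all choices of signs, of the norms of the signed sums. -/
noncomputable def signNormSum {E : Type*} [NormedAddCommGroup E] [NormedSpace ℝ E] {N : ℕ}
    (u : Fin N → E) : ℝ := ∑ ε : Fin N → Bool, ‖∑ i, boolSign (ε i) • u i‖

lemma signNormSum_le_of_mem_convexHull {E : Type*} [NormedAddCommGroup E] [NormedSpace ℝ E]
    {N : ℕ} {S : Set E} {B : ℝ} (h : ∀ u : Fin N → E, (∀ i, u i ∈ S) → signNormSum u ≤ B)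
    {u : Fin N → E} (hu : ∀ i, u i ∈ convexHull ℝ S) : signNormSum u ≤ B := by
  have hconv : Convex ℝ {u : Fin N → E | signNormSum u ≤ B} := by
    intro u hu v hv a b ha hb hab
    simp only [mem_ofPred_eq] at hu hv ⊢
    calc signNormSum (a • u + b • v) ≤ a * signNormSum u + b * signNormSum v := by
          simp only [signNormSum]
          rw [Finset.mul_sum, Finset.mul_sum, ← Finset.sum_add_distrib]
          refine Finset.sum_le_sum fun ε _ => ?_
          have : ∑ i, boolSign (ε i) • (a • u + b • v) i =
              a • ∑ i, boolSign (ε i) • u i + b • ∑ i, boolSign (ε i) • v i := by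
            rw [Finset.smul_sum, Finset.smul_sum, ← Finset.sum_add_distrib]
            refine Finset.sum_congr rfl fun i _ => ?_
            simp only [Pi.add_apply, Pi.smul_apply, smul_add]
            rw [smul_comm, smul_comm (boolSign (ε i)) b]
          rw [this]
          refine (norm_add_le _ _).trans (le_of_eq ?_)
          rw [norm_smul, norm_smul, Real.norm_of_nonneg ha, Real.norm_of_nonneg hb]
      _ ≤ a * B + b * B := by gcongr
      _ = B := by rw [← add_mul, hab, one_mul]
  have hsub : Set.pi univ (fun _ : Fin N => S) ⊆ {u : Fin N → E | signNormSum u ≤ B} :=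
    fun u hu => h u fun i => hu i (mem_univ i)
  exact convexHull_min hsub hconv (mem_convexHull_pi fun i _ => hu i)

lemma sum_half_pow_le (s : Finset ℕ) : ∑ n ∈ s, (2⁻¹ : ℝ) ^ n ≤ 2 := by
  have h := summable_geometric_two.sum_le_tsum s (fun i _ => by positivity)
  rw [tsum_geometric_two] at h
  simpa using h

lemma signNormSum_indicators_le {P : Γ → K → Prop} (hP : ∀ γ, IsClopen {t | P γ t})
    {cls : Γ → ℕ} (h : NoIndependentTriple P cls) {N : ℕ} (γ : Fin N → Γ) (c : Fin N → ℝ)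
    (hc : ∀ i, |c i| ≤ 1) {δ : ℝ} (hδ : 0 < δ) :
    signNormSum (fun i => c i • weightedIndicator P hP cls (γ i)) ≤
      2 ^ N * (2 * N * (δ + 2 * (N + 1) ^ 2 * Real.exp (-(δ ^ 2 / 2 * N)))) := by
  classical
  set I := Finset.univ.image fun i => cls (γ i) with hI
  let S : Finset (Fin N) → (Fin N → Bool) → ℝ := fun A ε =>
    ∑ i, boolSign (ε i) * (if i ∈ A then c i else 0)
  let G : (Fin N → Bool) → ℝ := fun ε => ∑ n ∈ I, 2⁻¹ ^ n * (δ * N +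
    N * Real.exp (-(δ ^ 2 * N)) * ∑ A ∈ traces P cls γ n,
      (Real.exp (δ * S A ε) + Real.exp (-δ * S A ε)))
  have hd : ∀ (A : Finset (Fin N)) i, |if i ∈ A then c i else 0| ≤ 1 := by
    intro A i
    split_ifs
    · exact hc i
    · simp
  have hSN : ∀ A ε, |S A ε| ≤ N := by
    intro A ε
    refine (Finset.abs_sum_le_sum_abs _ _).trans ?_
    calc _ ≤ ∑ _i : Fin N, (1 : ℝ) := Finset.sum_le_sum fun i _ => by
          rw [abs_mul, abs_boolSign, one_mul]; exact hd A i
      _ = N := by simp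
  have hG : ∀ ε, 0 ≤ G ε := fun ε => Finset.sum_nonneg fun n _ => by
    have : 0 ≤ ∑ A ∈ traces P cls γ n, (Real.exp (δ * S A ε) + Real.exp (-δ * S A ε)) :=
      Finset.sum_nonneg fun A _ => by positivity
    positivity
  have hnorm : ∀ ε, ‖∑ i, boolSign (ε i) • c i • weightedIndicator P hP cls (γ i)‖ ≤ G ε := by
    intro ε
    refine (ContinuousMap.norm_le _ (hG ε)).2 fun t => ?_
    let A : ℕ → Finset (Fin N) := fun n => {i | cls (γ i) = n ∧ P (γ i) t}
    have hA : ∀ n, A n ∈ traces P cls γ n := fun n => by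
      simp only [traces, Finset.mem_filter, Finset.mem_univ, true_and]
      exact ⟨t, rfl⟩
    have e : (∑ i, boolSign (ε i) • c i • weightedIndicator P hP cls (γ i)) t =
        ∑ n ∈ I, 2⁻¹ ^ n * S (A n) ε := by
      rw [ContinuousMap.sum_apply]
      simp only [S, Finset.mul_sum]
      rw [Finset.sum_comm]
      refine Finset.sum_congr rfl fun i _ => ?_
      rw [Finset.sum_eq_single (cls (γ i))]
      · simp only [ContinuousMap.smul_apply, weightedIndicator, ContinuousMap.coe_mk, smul_eq_mul,
          A, Finset.mem_filter, Finset.mem_univ, true_and]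
        split_ifs <;> ring
      · intro n _ hn
        simp [A, hn.symm]
      · intro hi
        exact absurd (Finset.mem_image_of_mem _ (Finset.mem_univ i)) hi
    rw [e, Real.norm_eq_abs]
    refine (Finset.abs_sum_le_sum_abs _ _).trans (Finset.sum_le_sum fun n _ => ?_)
    rw [abs_mul, abs_of_nonneg (by positivity : (0 : ℝ) ≤ 2⁻¹ ^ n)]
    gcongr
    refine (abs_le_of_exp hδ (Nat.cast_nonneg N) (hSN _ _)).trans ?_
    gcongr
    exact Finset.single_le_sum (f := fun A => Real.exp (δ * S A ε) + Real.exp (-δ * S A ε))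
      (fun A _ => by positivity) (hA n)
  have hsum : ∀ n, ∑ ε : Fin N → Bool, ∑ A ∈ traces P cls γ n,
      (Real.exp (δ * S A ε) + Real.exp (-δ * S A ε)) ≤
        (N + 1) ^ 2 * (2 * (2 ^ N * Real.exp (δ ^ 2 / 2 * N))) := by
    intro n
    rw [Finset.sum_comm]
    calc _ ≤ ∑ _A ∈ traces P cls γ n, 2 * (2 ^ N * Real.exp (δ ^ 2 / 2 * N)) := by
          refine Finset.sum_le_sum fun A _ => ?_
          rw [Finset.sum_add_distrib]
          have h1 := sum_exp_signs_le N δ _ (hd A)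
          have h2 := sum_exp_signs_le N (-δ) _ (hd A)
          rw [neg_sq] at h2
          linarith
      _ = (traces P cls γ n).card * (2 * (2 ^ N * Real.exp (δ ^ 2 / 2 * N))) := by
          rw [Finset.sum_const, nsmul_eq_mul]
      _ ≤ _ := by
          gcongr
          exact_mod_cast card_traces_le h γ n
  calc _ ≤ ∑ ε, G ε := Finset.sum_le_sum fun ε _ => hnorm ε
    _ = ∑ n ∈ I, 2⁻¹ ^ n * (2 ^ N * (δ * N) + N * Real.exp (-(δ ^ 2 * N)) *
          ∑ ε : Fin N → Bool, ∑ A ∈ traces P cls γ n,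
            (Real.exp (δ * S A ε) + Real.exp (-δ * S A ε))) := by
        simp only [G]
        rw [Finset.sum_comm]
        refine Finset.sum_congr rfl fun n _ => ?_
        rw [← Finset.mul_sum, Finset.sum_add_distrib, Finset.sum_const, ← Finset.mul_sum]
        simp
    _ ≤ ∑ n ∈ I, 2⁻¹ ^ n * (2 ^ N * (δ * N) + N * Real.exp (-(δ ^ 2 * N)) *
          ((N + 1) ^ 2 * (2 * (2 ^ N * Real.exp (δ ^ 2 / 2 * N))))) := by
        gcongr with n _
        exact hsum n
    _ = (∑ n ∈ I, 2⁻¹ ^ n) * (2 ^ N * (N * (δ + 2 * (N + 1) ^ 2 *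
          Real.exp (-(δ ^ 2 / 2 * N))))) := by
        rw [← Finset.sum_mul]
        congr 1
        have : Real.exp (-(δ ^ 2 / 2 * N)) =
            Real.exp (-(δ ^ 2 * N)) * Real.exp (δ ^ 2 / 2 * N) := by
          rw [← Real.exp_add]; congr 1; ring
        rw [this]; ring
    _ ≤ 2 * (2 ^ N * (N * (δ + 2 * (N + 1) ^ 2 * Real.exp (-(δ ^ 2 / 2 * N))))) := by
        gcongr
        exact sum_half_pow_le I
    _ = _ := by ring

/-- The `ℓ¹` norm on finitely supported functions. -/
noncomputable def finsuppL1 (Γ : Type*) : Seminorm ℝ (Γ →₀ ℝ) :=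
  Seminorm.of (fun v => v.sum fun _ a => |a|)
    (fun v w => by
      classical
      rw [Finsupp.sum_of_support_subset v Finset.subset_union_left (s := v.support ∪ w.support) _
          (by simp), Finsupp.sum_of_support_subset w Finset.subset_union_right
          (s := v.support ∪ w.support) _ (by simp),
        Finsupp.sum_of_support_subset (v + w) Finsupp.support_add _ (by simp),
        ← Finset.sum_add_distrib]
      exact Finset.sum_le_sum fun i _ => abs_add_le _ _)
    (fun c v => by
      rw [Finsupp.sum_of_support_subset (c • v) Finsupp.support_smul _ (by simp), Finsupp.sum,
        Finset.mul_sum]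
      exact Finset.sum_congr rfl fun i _ => by simp [abs_mul])

lemma finsuppL1_apply (v : Γ →₀ ℝ) : finsuppL1 Γ v = ∑ i ∈ v.support, |v i| := rfl

lemma linearCombination_mem_convexHull {E : Type*} [NormedAddCommGroup E] [NormedSpace ℝ E]
    [Nonempty Γ] (w : Γ → E) {v : Γ →₀ ℝ} (hv : finsuppL1 Γ v ≤ 1) :
    Finsupp.linearCombination ℝ w v ∈ convexHull ℝ {x | ∃ c : ℝ, |c| ≤ 1 ∧ ∃ γ, x = c • w γ} := by
  rw [Finsupp.linearCombination_apply, Finsupp.sum]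
  rw [finsuppL1_apply] at hv
  set s := ∑ i ∈ v.support, |v i| with hs
  rcases eq_or_ne v.support ∅ with h0 | h0
  · rw [h0, Finset.sum_empty]
    exact subset_convexHull _ _ ⟨0, by simp, Classical.arbitrary Γ, by simp⟩
  · have hs0 : 0 < s := Finset.sum_pos (fun i hi => abs_pos.2 (Finsupp.mem_support_iff.1 hi))
      (Finset.nonempty_iff_ne_empty.2 h0)
    have : ∑ i ∈ v.support, v i • w i =
        ∑ i ∈ v.support, (|v i| / s) • ((s * SignType.sign (v i)) • w i) := by
      refine Finset.sum_congr rfl fun i hi => ?_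
      rw [smul_smul]
      congr 1
      field_simp
      rw [mul_comm, sign_mul_abs]
    rw [this]
    refine (convex_convexHull ℝ _).sum_mem (fun i _ => by positivity) ?_ fun i _ =>
      subset_convexHull _ _ ⟨_, ?_, i, rfl⟩
    · rw [← Finset.sum_div, div_self hs0.ne']
    · rw [abs_mul, abs_of_pos hs0]
      refine (mul_le_of_le_one_right hs0.le ?_).trans hv
      rcases lt_trichotomy (v i) 0 with h | h | h <;> simp [h]

lemma exists_pow_mul_exp_le {δ : ℝ} (hδ : 0 < δ) :
    ∃ N : ℕ, 0 < N ∧ 2 * ((N : ℝ) + 1) ^ 2 * Real.exp (-(δ ^ 2 / 2 * N)) ≤ δ := by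
  have hb : 0 < δ ^ 2 / 2 := by positivity
  have h1 : Filter.Tendsto (fun N : ℕ => 2 * ((N : ℝ) + 1) ^ 2 * Real.exp (-(δ ^ 2 / 2 * N)))
      Filter.atTop (nhds 0) := by
    have h2 := (Real.tendsto_pow_mul_exp_neg_atTop_nhds_zero 2).comp
      ((Filter.tendsto_atTop_add_const_right _ (δ ^ 2 / 2) Filter.tendsto_id).comp
        (tendsto_natCast_atTop_atTop (R := ℝ) |>.const_mul_atTop hb))
    have h3 := h2.const_mul (2 * (δ ^ 2 / 2)⁻¹ ^ 2 * Real.exp (δ ^ 2 / 2))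
    rw [mul_zero] at h3
    refine h3.congr fun N => ?_
    simp only [comp_apply, id]
    rw [neg_add, Real.exp_add, Real.exp_neg (δ ^ 2 / 2)]
    have := Real.exp_pos (δ ^ 2 / 2)
    field_simp
  obtain ⟨N, h, hN⟩ := ((h1.eventually (ge_mem_nhds hδ)).and
    (Filter.eventually_gt_atTop 0)).exists
  exact ⟨N, hN, h⟩

lemma signAveraging_linearCombination [Nonempty Γ] {P : Γ → K → Prop}
    (hP : ∀ γ, IsClopen {t | P γ t}) {cls : Γ → ℕ} (h : NoIndependentTriple P cls) :
    SignAveraging (Finsupp.linearCombination ℝ (weightedIndicator P hP cls)) (finsuppL1 Γ) := by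
  intro δ₀ hδ₀
  obtain ⟨δ, hδ, rfl⟩ : ∃ δ > 0, δ₀ = 4 * δ := ⟨δ₀ / 4, by positivity, by ring⟩
  obtain ⟨N, hN, hexp⟩ := exists_pow_mul_exp_le hδ
  refine ⟨N, hN, fun a ha => ?_⟩
  let u : Fin N → C(K, ℝ) := fun i => Finsupp.linearCombination ℝ (weightedIndicator P hP cls) (a i)
  have hu : signNormSum u ≤ 2 ^ N * (4 * δ * N) := by
    refine signNormSum_le_of_mem_convexHull (fun x hx => ?_)
      fun i => linearCombination_mem_convexHull _ (ha i)
    choose c hc γ hγ using hx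
    obtain rfl : x = fun i => c i • weightedIndicator P hP cls (γ i) := funext hγ
    refine (signNormSum_indicators_le hP h γ c hc hδ).trans ?_
    have : (0 : ℝ) ≤ N := Nat.cast_nonneg N
    refine mul_le_mul_of_nonneg_left ?_ (by positivity)
    calc _ ≤ 2 * N * (δ + δ) := by gcongr
      _ = _ := by ring
  obtain ⟨ε, -, hε⟩ : ∃ ε ∈ (Finset.univ : Finset (Fin N → Bool)),
      ‖∑ i, boolSign (ε i) • u i‖ ≤ 4 * δ * N := by
    refine Finset.exists_le_of_sum_le Finset.univ_nonempty ?_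
    refine hu.trans (le_of_eq ?_)
    simp
  refine ⟨fun i => if hi : i < N then boolSign (ε ⟨i, hi⟩) else 1, fun i => ?_, ?_⟩
  · dsimp only
    split_ifs
    · exact abs_boolSign _
    · simp
  · rw [Finset.sum_range, map_sum]
    simpa [u] using hε

end Clopen

/-- A compact space with a separating family of clopen sets, which is a countable union of classes
without independent triples, is weakly Radon–Nikodým. -/
theorem isWRN_of_clopen_family {K Γ : Type} [TopologicalSpace K] [CompactSpace K] [Nonempty Γ]
    {P : Γ → K → Prop} (hP : ∀ γ, IsClopen {t | P γ t}) {cls : Γ → ℕ}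
    (h : NoIndependentTriple P cls) (hsep : ∀ t t', (∀ γ, P γ t ↔ P γ t') → t = t') :
    IsWRN K := by
  have hle : ∀ v, ‖Finsupp.linearCombination ℝ (weightedIndicator P hP cls) v‖ ≤
      finsuppL1 Γ v := by
    intro v
    rw [Finsupp.linearCombination_apply, Finsupp.sum, finsuppL1_apply]
    refine norm_sum_le_of_le _ fun γ _ => ?_
    rw [norm_smul, Real.norm_eq_abs]
    refine mul_le_of_le_one_right (abs_nonneg _) ?_
    rw [ContinuousMap.norm_le _ zero_le_one]
    intro t
    simp only [weightedIndicator, ContinuousMap.coe_mk]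
    split_ifs
    · rw [Real.norm_of_nonneg (by positivity)]
      exact pow_le_one₀ (by norm_num) (by norm_num)
    · simp
  obtain ⟨X, i1, i2, i3, j, hX, hj⟩ :=
    exists_factor_not_containsL1 hle (signAveraging_linearCombination hP h)
  let F : K → WeakDual ℝ X := fun t => StrongDual.toWeakDual ((ContinuousMap.evalCLM ℝ t).comp j)
  have hF : ∀ t x, F t x = j x t := fun t x => rfl
  have hcont : Continuous F := by
    refine WeakDual.continuous_of_continuous_eval fun x => ?_
    simp only [hF]
    exact (j x).continuous
  have hinj : Injective F := by
    intro t t' htt'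
    refine hsep t t' fun γ => ?_
    obtain ⟨x, hx⟩ := hj (Finsupp.single γ 1)
    have h1 : j x t = j x t' := by rw [← hF, ← hF, htt']
    rw [hx, Finsupp.linearCombination_single, one_smul] at h1
    simp only [weightedIndicator, ContinuousMap.coe_mk] at h1
    have h0 : (2⁻¹ : ℝ) ^ cls γ ≠ 0 := by positivity
    by_cases h2 : P γ t <;> by_cases h3 : P γ t'
    · exact iff_of_true h2 h3
    · rw [if_pos h2, if_neg h3] at h1
      exact absurd h1 h0
    · rw [if_neg h2, if_pos h3] at h1
      exact absurd h1.symm h0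
    · exact iff_of_false h2 h3
  refine ⟨X, i1, i2, i3, range F, hX, isCompact_range hcont, ⟨?_⟩⟩
  exact (hcont.isClosedEmbedding hinj).isEmbedding.toHomeomorph

/-- A branch of bounded height `lvl` in the tree whose successors are labelled by pairs of a
sequence of natural numbers and a set of levels. -/
@[ext] structure Stem (W : Type) [LinearOrder W] where
  /-- The height. -/
  lvl : W
  /-- The labels. -/
  br : W → (ℕ → ℕ) × Set W
  br_eq : ∀ β, lvl ≤ β → br β = (0, ∅)

/-- A stem together with a sequence of natural numbers. -/
@[ext] structure Node (W : Type) [LinearOrder W] where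
  /-- The underlying stem. -/
  stem : Stem W
  /-- The sequence. -/
  x : ℕ → ℕ

section Tree

variable {W : Type} [LinearOrder W]

/-- The stem `q` is an initial segment of `r`. -/
def Stem.IsInit (q r : Stem W) : Prop :=
  q.lvl ≤ r.lvl ∧ ∀ β < q.lvl, q.br β = r.br β

lemma Stem.IsInit.refl (q : Stem W) : q.IsInit q := ⟨le_rfl, fun _ _ => rfl⟩

lemma Stem.IsInit.trans {q r s : Stem W} (h : q.IsInit r) (h' : r.IsInit s) : q.IsInit s :=
  ⟨h.1.trans h'.1, fun β hβ => (h.2 β hβ).trans (h'.2 β (hβ.trans_le h.1))⟩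

/-- The node of height `β` determined by a branch. -/
noncomputable def Stem.cut (q : Stem W) (β : W) : Node W where
  stem :=
    { lvl := β
      br := fun γ => if γ < β then q.br γ else (0, ∅)
      br_eq := fun _ hγ => if_neg hγ.not_gt }
  x := (q.br β).1

/-- The tree-like strict order on nodes. -/
def Node.Prec (y z : Node W) : Prop :=
  y.stem.lvl < z.stem.lvl ∧ z.stem.cut y.stem.lvl = y

lemma Node.prec_iff {y z : Node W} : y.Prec z ↔
    y.stem.lvl < z.stem.lvl ∧ y.stem.IsInit z.stem ∧ (z.stem.br y.stem.lvl).1 = y.x := by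
  constructor
  · rintro ⟨h, e⟩
    refine ⟨h, ⟨h.le, fun β hβ => ?_⟩, ?_⟩
    · have := congrArg (fun n : Node W => n.stem.br β) e
      simpa [Stem.cut, hβ] using this.symm
    · exact congrArg Node.x e
  · rintro ⟨h, e, hx⟩
    refine ⟨h, Node.ext (Stem.ext rfl (funext fun β => ?_)) hx⟩
    simp only [Stem.cut]
    split_ifs with hβ
    · exact (e.2 β hβ).symm
    · exact (y.stem.br_eq β (not_lt.1 hβ)).symm

lemma Stem.exists_sup [WellFoundedLT W]
    (hW : ∀ s : Set W, s.Countable → ∃ b, ∀ a ∈ s, a < b) (q : ℕ → Stem W)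
    (hq : ∀ n, (q n).IsInit (q (n + 1))) :
    ∃ r : Stem W, (∀ n, (q n).IsInit r) ∧ ∀ β < r.lvl, ∃ n, β < (q n).lvl := by
  classical
  have hmono : ∀ n m, n ≤ m → (q n).IsInit (q m) := by
    intro n m h
    induction m, h using Nat.le_induction with
    | base => exact Stem.IsInit.refl _
    | succ m _ ih => exact ih.trans (hq m)
  obtain ⟨b, hb⟩ := hW (range fun n => (q n).lvl) (countable_range _)
  have hne : {b : W | ∀ n, (q n).lvl ≤ b}.Nonempty := ⟨b, fun n => (hb _ ⟨n, rfl⟩).le⟩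
  set l := WellFounded.min (wellFounded_lt (α := W)) _ hne with hl
  have hlu : ∀ n, (q n).lvl ≤ l := WellFounded.min_mem (wellFounded_lt (α := W)) _ hne
  have hll : ∀ β < l, ∃ n, β < (q n).lvl := by
    intro β hβ
    by_contra! h
    exact WellFounded.not_lt_min (wellFounded_lt (α := W)) {b : W | ∀ n, (q n).lvl ≤ b} h hβ
  refine ⟨⟨l, fun β => if h : ∃ n, β < (q n).lvl then (q (Nat.find h)).br β else (0, ∅),
    fun β hβ => dif_neg ?_⟩, fun n => ⟨hlu n, fun β hβ => ?_⟩, hll⟩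
  · rintro ⟨n, hn⟩
    exact absurd (hn.trans_le (hlu n)) hβ.not_gt
  · have h : ∃ n, β < (q n).lvl := ⟨n, hβ⟩
    simp only [dif_pos h]
    exact ((hmono _ n (Nat.find_min' h hβ)).2 β (Nat.find_spec h)).symm

lemma exists_infinite_splitting (c : (ℕ → ℕ) → ℕ) : ∃ σ : List ℕ,
    {i | ∃ x : ℕ → ℕ, (List.range σ.length).map x = σ ∧ x σ.length = i ∧
      c x = σ.length}.Infinite := by
  by_contra! h
  have hb : ∀ σ : List ℕ, ∃ b, ∀ i, (∃ x : ℕ → ℕ, (List.range σ.length).map x = σ ∧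
      x σ.length = i ∧ c x = σ.length) → i < b := fun σ => by
    obtain ⟨b, hb⟩ := (h σ).bddAbove
    exact ⟨b + 1, fun i hi => Nat.lt_succ_of_le (hb hi)⟩
  choose b hb using hb
  let L : ℕ → List ℕ := fun n => Nat.rec [] (fun _ l => l ++ [b l]) n
  let x : ℕ → ℕ := fun n => b (L n)
  have hL : ∀ n, (List.range n).map x = L n := by
    intro n
    induction n with
    | zero => rfl
    | succ n ih => rw [List.range_succ, List.map_append, ih]; rfl
  have hlen : ∀ n, (L n).length = n := fun n => by rw [← hL]; simp
  have := hb (L (c x)) (x (c x)) ⟨x, by rw [hlen, hL], by rw [hlen], by rw [hlen]⟩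
  exact lt_irrefl _ this

/-- The combinatorial core: colourings and finite exceptional sets on the tree admit homogeneous
free sequences of a prescribed pattern. -/
theorem exists_homogeneous_sequence [WellFoundedLT W]
    (hW : ∀ s : Set W, s.Countable → ∃ b, ∀ a ∈ s, a < b)
    (c : Node W → ℕ) (E : Node W → Finset (Node W)) :
    ∃ (k : ℕ) (y : ℕ → Node W), (∀ n, c (y n) = k) ∧
      (∀ n m, ∀ j < k, (y n).x j = (y m).x j) ∧ (∀ n m, n ≠ m → (y n).x k ≠ (y m).x k) ∧
      (∀ n m, n < m → (y n).Prec (y m) ∧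
        ((y m).stem.br (y n).stem.lvl).2 = {α | ∃ j < n, α = (y j).stem.lvl}) ∧
      ∀ n l, l ≠ n → y l ∉ E (y n) := by
  classical
  have h1 : ∀ q : Stem W, ∃ σ : List ℕ, ∃ x : ℕ → ℕ → ℕ, {i | (List.range σ.length).map (x i) = σ ∧
      x i σ.length = i ∧ c ⟨q, x i⟩ = σ.length}.Infinite := by
    intro q
    obtain ⟨σ, hσ⟩ := exists_infinite_splitting fun x => c ⟨q, x⟩
    refine ⟨σ, fun i => if h : ∃ x : ℕ → ℕ, (List.range σ.length).map x = σ ∧ x σ.length = i ∧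
      c ⟨q, x⟩ = σ.length then h.choose else 0, hσ.mono fun i hi => ?_⟩
    have h : ∃ x : ℕ → ℕ, (List.range σ.length).map x = σ ∧ x σ.length = i ∧
      c ⟨q, x⟩ = σ.length := hi
    simp only [mem_ofPred_eq, dif_pos h]
    exact h.choose_spec
  choose C X hX using h1
  let I : Stem W → Set ℕ := fun q => {i | (List.range (C q).length).map (X q i) = C q ∧
      X q i (C q).length = i ∧ c ⟨q, X q i⟩ = (C q).length}
  let Good : List ℕ → ℕ → W → Stem W → Prop := fun σ i β q =>
    C q = σ ∧ i ∈ I q ∧ ∀ z ∈ E ⟨q, X q i⟩, z.stem.lvl < q.lvl → z.stem.lvl < β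
  obtain ⟨b₀, -⟩ := hW ∅ countable_empty
  have h2 : ∃ q : Stem W, ∀ i ∈ I q, ∃ β ≤ q.lvl, ∀ r, q.IsInit r →
      ∃ q', r.IsInit q' ∧ Good (C q) i β q' := by
    let dec : ℕ → List ℕ × ℕ := fun n =>
      ((Encodable.decode (n.unpair).2 : Option (List ℕ × ℕ))).getD ([], 0)
    have hstep : ∀ (n : ℕ) (q : Stem W), ∃ r, q.IsInit r ∧
        ((∃ r', q.IsInit r' ∧ ∀ q', r'.IsInit q' → ¬ Good (dec n).1 (dec n).2 q.lvl q') →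
          ∀ q', r.IsInit q' → ¬ Good (dec n).1 (dec n).2 q.lvl q') := by
      intro n q
      by_cases h : ∃ r', q.IsInit r' ∧ ∀ q', r'.IsInit q' → ¬ Good (dec n).1 (dec n).2 q.lvl q'
      · obtain ⟨r', hr', h'⟩ := h
        exact ⟨r', hr', fun _ => h'⟩
      · exact ⟨q, Stem.IsInit.refl q, fun h' => absurd h' h⟩
    choose step hs1 hs2 using hstep
    let Q : ℕ → Stem W := fun n => Nat.rec ⟨b₀, fun _ => (0, ∅), fun _ _ => rfl⟩ step n
    have hQ : ∀ n, Q (n + 1) = step n (Q n) := fun n => rfl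
    obtain ⟨q, hq1, hq2⟩ := Stem.exists_sup hW Q fun n => hs1 n (Q n)
    refine ⟨q, fun i hi => ?_⟩
    obtain ⟨j, hj⟩ : ∃ j, ∀ n ≥ j, ∀ z ∈ E ⟨q, X q i⟩, z.stem.lvl < q.lvl →
        z.stem.lvl < (Q n).lvl := by
      have hmono : Monotone fun n => (Q n).lvl := monotone_nat_of_le_succ fun n => (hs1 n (Q n)).1
      have : ∀ᶠ n in Filter.atTop, ∀ z ∈ E ⟨q, X q i⟩, z.stem.lvl < q.lvl →
          z.stem.lvl < (Q n).lvl := by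
        refine (Filter.eventually_all_finset _).2 fun z _ => ?_
        by_cases hz : z.stem.lvl < q.lvl
        · obtain ⟨n, hn⟩ := hq2 _ hz
          exact (Filter.eventually_ge_atTop n).mono fun m hm _ => hn.trans_le (hmono hm)
        · exact Filter.Eventually.of_forall fun _ h => absurd h hz
      exact Filter.eventually_atTop.1 this
    let n := Nat.pair j (Encodable.encode (C q, i))
    have hdec : dec n = (C q, i) := by simp [dec, n]
    refine ⟨(Q n).lvl, (hq1 n).1, fun r hr => ?_⟩
    by_contra! h
    have h3 := hs2 n (Q n) ⟨r, (hq1 n).trans hr, by rw [hdec]; exact h⟩ q (hq1 (n + 1))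
    rw [hdec] at h3
    exact h3 ⟨rfl, hi, hj n (Nat.left_le_pair _ _)⟩
  obtain ⟨q, hq⟩ := h2
  let f := (hX q).natEmbedding
  have hnext : ∀ (n : ℕ) (r : {r : Stem W // q.IsInit r}) (A : Set W), ∃ (q' : Stem W)
      (r' : {r : Stem W // q.IsInit r}), r.1.IsInit q' ∧ C q' = C q ∧ (f n : ℕ) ∈ I q' ∧
      (∀ z ∈ E ⟨q', X q' (f n)⟩, z.stem.lvl < q'.lvl → z.stem.lvl < q.lvl) ∧
      q'.IsInit r'.1 ∧ q'.lvl < r'.1.lvl ∧ r'.1.br q'.lvl = (X q' (f n), A) ∧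
      ∀ z ∈ E ⟨q', X q' (f n)⟩, z.stem.lvl < r'.1.lvl := by
    intro n r A
    obtain ⟨β, hβ, h⟩ := hq (f n) (f n).2
    obtain ⟨q', hq', hC, hI, hE⟩ := h r.1 r.2
    obtain ⟨b, hb⟩ := hW (insert q'.lvl ((fun z : Node W => z.stem.lvl) '' (E ⟨q', X q' (f n)⟩)))
      (((Finset.finite_toSet _).image _).insert _).countable
    have hb1 : q'.lvl < b := hb _ (mem_insert _ _)
    let r' : Stem W := ⟨b, Function.update q'.br q'.lvl (X q' (f n), A), fun γ hγ => by
      rw [Function.update_of_ne (hb1.trans_le hγ).ne']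
      exact q'.br_eq γ (hb1.le.trans hγ)⟩
    have hr' : q'.IsInit r' := ⟨hb1.le, fun γ hγ => (Function.update_of_ne hγ.ne _ _).symm⟩
    exact ⟨q', ⟨r', (r.2.trans hq').trans hr'⟩, hq', hC, hI,
      fun z hz h => (hE z hz h).trans_le hβ, hr', hb1, Function.update_self _ _ _,
      fun z hz => hb _ (mem_insert_of_mem _ ⟨z, hz, rfl⟩)⟩
  choose nq nr g1 g2 g3 g4 g5 g6 g7 g8 using hnext
  let st : ℕ → {r : Stem W // q.IsInit r} × Set W := fun n =>
    Nat.rec (⟨q, Stem.IsInit.refl q⟩, ∅)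
      (fun n s => (nr n s.1 s.2, insert (nq n s.1 s.2).lvl s.2)) n
  have hst : ∀ n, st (n + 1) = (nr n (st n).1 (st n).2,
    insert (nq n (st n).1 (st n).2).lvl (st n).2) := fun n => rfl
  let Qs : ℕ → Stem W := fun n => nq n (st n).1 (st n).2
  have k1 : ∀ n, (st n).1.1.IsInit (Qs n) := fun n => g1 _ _ _
  have k5 : ∀ n, (Qs n).IsInit (st (n + 1)).1.1 := fun n => g5 _ _ _
  have hR : ∀ n m, n ≤ m → (st n).1.1.IsInit (st m).1.1 := by
    intro n m h
    induction m, h using Nat.le_induction with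
    | base => exact Stem.IsInit.refl _
    | succ m _ ih => exact ih.trans ((k1 m).trans (k5 m))
  have hRQ : ∀ n m, n < m → (st (n + 1)).1.1.IsInit (Qs m) := fun n m h =>
    (hR (n + 1) m h).trans (k1 m)
  have hA : ∀ n, (st n).2 = {α | ∃ j < n, α = (Qs j).lvl} := by
    intro n
    induction n with
    | zero => simp [st]
    | succ n ih =>
      rw [hst]
      have e : insert (Qs n).lvl (st n).2 = {α | ∃ j < n + 1, α = (Qs j).lvl} := by
        rw [ih]
        ext α
        simp only [mem_insert_iff, mem_ofPred_eq, Nat.lt_succ_iff_lt_or_eq, or_and_right,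
          exists_or, exists_eq_left]
        exact or_comm
      exact e
  have hlt : ∀ n m, n < m → (Qs n).lvl < (Qs m).lvl := fun n m h =>
    (g6 n (st n).1 (st n).2).trans_le (hRQ n m h).1
  have hbr : ∀ n m, n < m → (Qs m).br (Qs n).lvl = (X (Qs n) (f n), (st n).2) := fun n m h => by
    rw [← (hRQ n m h).2 _ (g6 n (st n).1 (st n).2)]
    exact g7 n (st n).1 (st n).2
  have hCQ : ∀ n, C (Qs n) = C q := fun n => g2 _ _ _
  have hIQ : ∀ n, (List.range (C q).length).map (X (Qs n) (f n)) = C q ∧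
      X (Qs n) (f n) (C q).length = f n ∧ c ⟨Qs n, X (Qs n) (f n)⟩ = (C q).length := fun n => by
    have := g3 n (st n).1 (st n).2
    simp only [I, mem_ofPred_eq, g2] at this
    exact this
  refine ⟨(C q).length, fun n => ⟨Qs n, X (Qs n) (f n)⟩, fun n => (hIQ n).2.2, fun n m j hj => ?_,
    fun n m hnm => ?_, fun n m h => ⟨?_, ?_⟩, fun n l hln hl => ?_⟩
  · have h := (hIQ n).1.trans (hIQ m).1.symm
    exact List.map_inj_left.1 h j (List.mem_range.2 hj)
  · simp only [(hIQ _).2.1]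
    exact fun h => hnm (f.injective (Subtype.ext h))
  · rw [Node.prec_iff]
    exact ⟨hlt n m h, (k5 n).trans (hRQ n m h), by simp only [hbr n m h]⟩
  · simp only [hbr n m h, hA]
  · rcases lt_or_gt_of_ne hln with h | h
    · have h3 := g4 n (st n).1 (st n).2 _ hl (hlt l n h)
      have h4 : q.lvl ≤ (Qs l).lvl := ((st l).1.2.trans (k1 l)).1
      exact absurd h3 h4.not_gt
    · have h3 := g8 n (st n).1 (st n).2 _ hl
      exact absurd h3 (hRQ n l h).1.not_gt

end Tree

section Compactum

variable {W : Type} [LinearOrder W]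

/-- The points of the compactum: families of binary sequences supported on chains of nodes, such
that below a node of the support the labels of any higher node of the support decide whether the
value vanishes or has to follow the value at the given node. -/
def treeCompactum (W : Type) [LinearOrder W] : Set (Node W → ℕ → Bool) :=
  {t | (∀ y z, t y ≠ (fun _ => false) → t z ≠ (fun _ => false) → y ≠ z → y.Prec z ∨ z.Prec y) ∧
    ∀ y z, t y ≠ (fun _ => false) → t z ≠ (fun _ => false) → y.Prec z → ∀ β < y.stem.lvl,
      (β ∈ (z.stem.br y.stem.lvl).2 → ∀ l, (∀ j ≤ l, y.x j = z.x j) →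
        t (y.stem.cut β) l = t y l) ∧
      (β ∉ (z.stem.br y.stem.lvl).2 → t (y.stem.cut β) = fun _ => false)}

lemma isClosed_forall {ι : Sort*} {X : Type*} [TopologicalSpace X] {p : ι → X → Prop}
    (h : ∀ i, IsClosed {x | p i x}) : IsClosed {x | ∀ i, p i x} := by
  have : {x | ∀ i, p i x} = ⋂ i, {x | p i x} := by ext; simp
  rw [this]
  exact isClosed_iInter h

lemma isClosed_treeCompactum : IsClosed (treeCompactum W) := by
  have h0 : ∀ y : Node W, IsOpen {t : Node W → ℕ → Bool | t y ≠ fun _ => false} := fun y =>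
    isOpen_ne.preimage (continuous_apply y)
  have hc : ∀ (y : Node W) l, Continuous fun t : Node W → ℕ → Bool => t y l := fun y l =>
    (continuous_apply l).comp (continuous_apply y)
  refine IsClosed.inter (isClosed_forall fun y => isClosed_forall fun z => ?_)
    (isClosed_forall fun y => isClosed_forall fun z => ?_)
  · exact isClosed_imp (h0 y) (isClosed_imp (h0 z) isClosed_const)
  · refine isClosed_imp (h0 y) (isClosed_imp (h0 z) (isClosed_imp isOpen_const
      (isClosed_forall fun β => isClosed_imp isOpen_const (IsClosed.inter
        (isClosed_imp isOpen_const (isClosed_forall fun l => isClosed_imp isOpen_const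
          (isClosed_eq (hc _ _) (hc _ _))))
        (isClosed_imp isOpen_const (isClosed_eq (continuous_apply _) continuous_const))))))

instance : CompactSpace (treeCompactum W) :=
  isCompact_iff_compactSpace.1 isClosed_treeCompactum.isCompact

/-- The clopen set of points whose value at a node has a given bit equal to one. -/
def bitSet (γ : Node W × ℕ) (t : treeCompactum W) : Prop := t.1 γ.1 γ.2 = true

lemma isClopen_bitSet (γ : Node W × ℕ) : IsClopen {t | bitSet (W := W) γ t} := by
  have : Continuous fun t : treeCompactum W => t.1 γ.1 γ.2 :=
    (continuous_apply γ.2).comp ((continuous_apply γ.1).comp continuous_subtype_val)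
  exact (isClopen_discrete {true}).preimage this

/-- The class of a pair `(y, l)`: a code of the first `l + 1` terms of the sequence of `y`. -/
def bitClass (γ : Node W × ℕ) : ℕ := Encodable.encode ((List.range (γ.2 + 1)).map γ.1.x)

lemma bitClass_eq {γ γ' : Node W × ℕ} (h : bitClass γ = bitClass γ') :
    γ.2 = γ'.2 ∧ ∀ j ≤ γ.2, γ.1.x j = γ'.1.x j := by
  have h1 := Encodable.encode_injective h
  have h2 : γ.2 = γ'.2 := by simpa using congrArg List.length h1
  refine ⟨h2, fun j hj => ?_⟩
  rw [← h2] at h1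
  exact List.map_inj_left.1 h1 j (List.mem_range.2 (Nat.lt_succ_of_le hj))

lemma not_independent_of_prec {a b c : Node W} {l : ℕ} (hab : a.Prec b) (hbc : b.Prec c)
    (hx : ∀ j ≤ l, b.x j = c.x j) {t₀ t₁ : treeCompactum W} (ha₀ : t₀.1 a l = true)
    (hb₀ : t₀.1 b l = true) (hc₀ : t₀.1 c l = true) (ha₁ : t₁.1 a l = false)
    (hb₁ : t₁.1 b l = true) (hc₁ : t₁.1 c l = true) : False := by
  have hne : ∀ (t : treeCompactum W) y, t.1 y l = true → t.1 y ≠ fun _ => false := by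
    intro t y h e
    rw [e] at h
    exact Bool.false_ne_true h
  have h₀ := t₀.2.2 b c (hne _ _ hb₀) (hne _ _ hc₀) hbc a.stem.lvl hab.1
  have h₁ := t₁.2.2 b c (hne _ _ hb₁) (hne _ _ hc₁) hbc a.stem.lvl hab.1
  rw [hab.2] at h₀ h₁
  by_cases hA : a.stem.lvl ∈ (c.stem.br b.stem.lvl).2
  · have := h₁.1 hA l hx
    rw [ha₁, hb₁] at this
    exact Bool.false_ne_true this
  · exact hne _ _ ha₀ (h₀.2 hA)

lemma noIndependentTriple_bitSet :
    NoIndependentTriple (bitSet (W := W)) bitClass := by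
  rintro ⟨a, l⟩ ⟨b, l'⟩ ⟨c, l''⟩ hab hbc h
  obtain ⟨h1, hxab⟩ := bitClass_eq hab
  obtain ⟨h2, hxbc⟩ := bitClass_eq hbc
  simp only at h1 h2 hxab hxbc
  subst h1 h2
  simp only [bitSet] at h
  obtain ⟨t, hta, htb, htc⟩ := h True True True
  obtain ⟨ta, haa, hab', hac⟩ := h False True True
  obtain ⟨tb, hba, hbb, hbc'⟩ := h True False True
  obtain ⟨tc, hca, hcb, hcc⟩ := h True True False
  simp only [iff_true, iff_false, Bool.not_eq_true] at *
  have hne : ∀ y, t.1 y l = true → t.1 y ≠ fun _ => false := by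
    intro y h e
    rw [e] at h
    exact Bool.false_ne_true h
  have hab0 : a ≠ b := by rintro rfl; rw [haa] at hab'; exact Bool.false_ne_true hab'
  have hac0 : a ≠ c := by rintro rfl; rw [haa] at hac; exact Bool.false_ne_true hac
  have hbc0 : b ≠ c := by rintro rfl; rw [hbb] at hbc'; exact Bool.false_ne_true hbc'
  have nab := t.2.1 a b (hne _ hta) (hne _ htb) hab0
  have nac := t.2.1 a c (hne _ hta) (hne _ htc) hac0
  have nbc := t.2.1 b c (hne _ htb) (hne _ htc) hbc0
  have hxac : ∀ j ≤ l, a.x j = c.x j := fun j hj => (hxab j hj).trans (hxbc j hj)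
  rcases nab with p | p <;> rcases nac with q | q <;> rcases nbc with r | r
  · exact not_independent_of_prec p r hxbc hta htb htc haa hab' hac
  · exact not_independent_of_prec q r (fun j hj => (hxbc j hj).symm) hta htc htb haa hac hab'
  · exact absurd ((p.1.trans r.1).trans q.1) (lt_irrefl _)
  · exact not_independent_of_prec q p hxab htc hta htb hcc hca hcb
  · exact not_independent_of_prec p q hxac htb hta htc hbb hba hbc'
  · exact absurd ((p.1.trans q.1).trans r.1) (lt_irrefl _)
  · exact not_independent_of_prec r q (fun j hj => (hxac j hj).symm) htb htc hta hbb hbc' hba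
  · exact not_independent_of_prec r p (fun j hj => (hxab j hj).symm) htc htb hta hcc hcb hca

theorem isWRN_treeCompactum [Nonempty W] : IsWRN (treeCompactum W) := by
  have : Nonempty (Node W) :=
    ⟨⟨⟨Classical.arbitrary W, fun _ => (0, ∅), fun _ _ => rfl⟩, 0⟩⟩
  refine isWRN_of_clopen_family isClopen_bitSet noIndependentTriple_bitSet fun t t' h => ?_
  refine Subtype.ext (funext fun y => funext fun l => ?_)
  have := h (y, l)
  simp only [bitSet] at this
  exact Bool.eq_iff_iff.2 this

lemma single_mem_treeCompactum [DecidableEq (Node W)] (y : Node W) (s : ℕ → Bool) :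
    Function.update (fun _ _ => false) y s ∈ treeCompactum W := by
  have h : ∀ z, Function.update (fun (_ : Node W) (_ : ℕ) => false) y s z ≠ (fun _ => false) →
      z = y := by
    intro z hz
    by_contra h
    exact hz (Function.update_of_ne h _ _)
  refine ⟨fun z z' hz hz' hne => absurd ((h z hz).trans (h z' hz').symm) hne,
    fun z z' hz hz' hp => ?_⟩
  rw [h z hz, h z' hz'] at hp
  exact absurd hp.1 (lt_irrefl _)

/-- A family of nodes as produced by `exists_homogeneous_sequence`. -/
structure IsHomogeneous (k : ℕ) (y : ℕ → Node W) : Prop where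
  x_eq : ∀ n m, ∀ j < k, (y n).x j = (y m).x j
  x_ne : ∀ n m, n ≠ m → (y n).x k ≠ (y m).x k
  prec : ∀ n m, n < m → (y n).Prec (y m)
  label : ∀ n m, n < m → ((y m).stem.br (y n).stem.lvl).2 = {α | ∃ j < n, α = (y j).stem.lvl}

lemma IsHomogeneous.lvl_strictMono {k : ℕ} {y : ℕ → Node W} (h : IsHomogeneous k y) :
    StrictMono fun n => (y n).stem.lvl := fun n m hnm => (h.prec n m hnm).1

lemma IsHomogeneous.injective {k : ℕ} {y : ℕ → Node W} (h : IsHomogeneous k y) : Injective y :=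
  fun n m e => h.lvl_strictMono.injective (by simp only [e])

lemma IsHomogeneous.extend_mem {k : ℕ} {y : ℕ → Node W} (h : IsHomogeneous k y)
    {T : ℕ → ℕ → Bool} (hT : ∀ n m, ∀ l < k, T n l = T m l) :
    Function.extend y T (fun _ _ => false) ∈ treeCompactum W := by
  have hs : ∀ z, Function.extend y T (fun _ _ => false) z ≠ (fun _ => false) → ∃ n, y n = z := by
    intro z hz
    by_contra h'
    exact hz (Function.extend_apply' _ _ _ h')
  refine ⟨fun z z' hz hz' hne => ?_, fun z z' hz hz' hp β hβ => ?_⟩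
  · obtain ⟨n, rfl⟩ := hs z hz
    obtain ⟨m, rfl⟩ := hs z' hz'
    rcases lt_trichotomy n m with hnm | rfl | hnm
    · exact Or.inl (h.prec n m hnm)
    · exact absurd rfl hne
    · exact Or.inr (h.prec m n hnm)
  · obtain ⟨n, rfl⟩ := hs z hz
    obtain ⟨m, rfl⟩ := hs z' hz'
    have hnm : n < m := h.lvl_strictMono.lt_iff_lt.1 hp.1
    rw [h.label n m hnm]
    refine ⟨?_, fun hβ' => ?_⟩
    · rintro ⟨j, hj, rfl⟩ l hl
      have hlk : l < k := by
        by_contra! hkl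
        exact h.x_ne n m hnm.ne (hl k hkl)
      rw [(h.prec j n hj).2, h.injective.extend_apply, h.injective.extend_apply]
      exact hT j n l hlk
    · by_contra h0
      obtain ⟨j, hj⟩ := hs _ h0
      have e : (y j).stem.lvl = β := by rw [hj]; rfl
      rw [← e] at hβ
      exact hβ' ⟨j, h.lvl_strictMono.lt_iff_lt.1 hβ, e.symm⟩

end Compactum

/-- The number with a given binary expansion. -/
noncomputable def binVal (s : ℕ → Bool) : ℝ :=
  Real.ofDigits (b := 2) fun n => if s n then 1 else 0

lemma continuous_binVal : Continuous binVal := by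
  refine Real.continuous_ofDigits.comp (continuous_pi fun n => ?_)
  exact (continuous_of_discreteTopology (f := fun b : Bool => (if b then 1 else 0 : Fin 2))).comp
    (continuous_apply n)

/-- The sequence with the first `k` terms those of `s`, and all other terms equal to `b`. -/
def word (s : ℕ → Bool) (k : ℕ) (b : Bool) : ℕ → Bool := fun n => if n < k then s n else b

lemma binVal_const_true : binVal (fun _ => true) = 1 := by
  have := Real.ofDigits_const_last_eq_one 1
  simpa [binVal] using this

lemma binVal_const_false : binVal (fun _ => false) = 0 := by
  simp [binVal, Real.ofDigits, Real.ofDigitsTerm]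

lemma binVal_glue (s : ℕ → Bool) (k : ℕ) :
    binVal (word (Function.update s k false) (k + 1) true) =
      binVal (word (Function.update s k true) (k + 1) false) := by
  have h1 := binVal_const_true
  have h0 := binVal_const_false
  simp only [binVal] at h1 h0 ⊢
  rw [Real.ofDigits_eq_sum_add_ofDigits _ (k + 1), Real.ofDigits_eq_sum_add_ofDigits
    (fun n => if word (Function.update s k true) (k + 1) false n = true then 1 else 0) (k + 1)]
  have e1 : ∀ i, word (Function.update s k false) (k + 1) true (i + (k + 1)) = true :=
    fun i => if_neg (by lia)
  have e0 : ∀ i, word (Function.update s k true) (k + 1) false (i + (k + 1)) = false :=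
    fun i => if_neg (by lia)
  simp only [e1, e0, h1, h0, Finset.sum_range_succ]
  have e2 : ∀ i ∈ Finset.range k, word (Function.update s k false) (k + 1) true i =
      word (Function.update s k true) (k + 1) false i := by
    intro i hi
    have hi := Finset.mem_range.1 hi
    simp [word, hi.ne, hi.trans (Nat.lt_succ_self k)]
  have e3 : ∀ b c, word (Function.update s k b) (k + 1) c k = b := fun b c => by simp [word]
  have e4 : ∀ i ∈ Finset.range k, Real.ofDigitsTerm (b := 2)
      (fun n => if word (Function.update s k false) (k + 1) true n = true then 1 else 0) i =
      Real.ofDigitsTerm (b := 2)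
      (fun n => if word (Function.update s k true) (k + 1) false n = true then 1 else 0) i :=
    fun i hi => by rw [Real.ofDigitsTerm, Real.ofDigitsTerm, e2 i hi]
  rw [Finset.sum_congr rfl e4, Real.ofDigitsTerm, Real.ofDigitsTerm, e3, e3]
  simp

lemma exists_word_gap {g : (ℕ → Bool) → ℝ}
    (hg : ∀ s k, g (word (Function.update s k false) (k + 1) true) =
      g (word (Function.update s k true) (k + 1) false))
    (h1 : 1 ≤ g (fun _ => true) - g fun _ => false) (k : ℕ) :
    ∃ s, 2⁻¹ ^ k ≤ g (word s k true) - g (word s k false) := by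
  induction k with
  | zero => exact ⟨fun _ => false, by
    have : ∀ b, word (fun _ => false) 0 b = fun _ => b := fun b => rfl
    simpa only [pow_zero, this] using h1⟩
  | succ k ih =>
    obtain ⟨s, hs⟩ := ih
    have hw : ∀ b, word (Function.update s k b) (k + 1) b = word s k b := fun b => by
      funext n
      simp only [word, Nat.lt_succ_iff_lt_or_eq]
      rcases lt_trichotomy n k with h | rfl | h
      · simp [h, h.ne]
      · simp
      · simp [h.not_gt, h.ne']
    have h := hg s k
    rw [← hw true, ← hw false] at hs
    rw [pow_succ]
    by_contra! hcon
    have c0 := hcon (Function.update s k false)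
    have c1 := hcon (Function.update s k true)
    linarith

lemma containsL1_of_signs {X : Type*} [NormedAddCommGroup X] [NormedSpace ℝ X] [CompleteSpace X]
    {x : ℕ → X} {C M δ : ℝ} (hx : ∀ n, ‖x n‖ ≤ C) (hδ : 0 < δ) {F : Set ℕ → StrongDual ℝ X}
    (hF : ∀ B, ‖F B‖ ≤ M) (h1 : ∀ B, ∀ n ∈ B, δ ≤ F B (x n))
    (h2 : ∀ B, ∀ n ∉ B, F B (x n) ≤ -δ) : ContainsL1 X := by
  have hM : 0 ≤ M := (norm_nonneg _).trans (hF ∅)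
  have hs : ∀ a : lp (fun _ : ℕ => ℝ) 1, Summable fun n => ‖a n‖ := fun a => by
    have := (lp.memℓp a).summable (by simp)
    simpa using this
  have hnorm : ∀ a : lp (fun _ : ℕ => ℝ) 1, ‖a‖ = ∑' n, ‖a n‖ := fun a => by
    have := lp.norm_eq_tsum_rpow (by simp) a
    simpa using this
  have hle : ∀ (a : lp (fun _ : ℕ => ℝ) 1) n, ‖a n • x n‖ ≤ C * ‖a n‖ := fun a n => by
    rw [norm_smul, mul_comm]
    exact mul_le_mul_of_nonneg_right (hx n) (norm_nonneg _)
  have hsx : ∀ a : lp (fun _ : ℕ => ℝ) 1, Summable fun n => a n • x n := fun a =>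
    Summable.of_norm_bounded ((hs a).mul_left C) (hle a)
  let T : lp (fun _ : ℕ => ℝ) 1 →ₗ[ℝ] X :=
    { toFun := fun a => ∑' n, a n • x n
      map_add' := fun a b => by
        rw [← (hsx a).tsum_add (hsx b)]
        simp [add_smul]
      map_smul' := fun r a => by
        rw [RingHom.id_apply, ← (hsx a).tsum_const_smul]
        simp [mul_smul] }
  refine ⟨T.mkContinuous C fun a => ?_, δ / (M + 1), by positivity, fun a => ?_⟩
  · rw [hnorm, ← tsum_mul_left]
    exact tsum_of_norm_bounded ((hs a).mul_left C).hasSum (hle a)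
  · have key : δ * ‖a‖ ≤ F {n | 0 ≤ a n} (∑' n, a n • x n) := by
      rw [ContinuousLinearMap.map_tsum _ (hsx a), hnorm, ← tsum_mul_left]
      refine ((hs a).mul_left δ).tsum_le_tsum (fun n => ?_) ((hsx a).mapL _)
      rw [map_smul, smul_eq_mul, Real.norm_eq_abs]
      by_cases hn : 0 ≤ a n
      · rw [abs_of_nonneg hn, mul_comm]
        exact mul_le_mul_of_nonneg_left (h1 _ n hn) hn
      · have := h2 {n | 0 ≤ a n} n hn
        rw [abs_of_neg (not_le.1 hn)]
        nlinarith
    have h3 : F {n | 0 ≤ a n} (∑' n, a n • x n) ≤ (M + 1) * ‖∑' n, a n • x n‖ :=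
      (le_abs_self _).trans (((F _).le_opNorm _).trans
        (mul_le_mul_of_nonneg_right ((hF _).trans (by linarith)) (norm_nonneg _)))
    rw [div_mul_eq_mul_div, div_le_iff₀ (by positivity), mul_comm ‖_‖]
    exact key.trans h3

lemma exists_norm_le_of_isCompact_weakDual {X : Type*} [NormedAddCommGroup X] [NormedSpace ℝ X]
    [CompleteSpace X] {S : Set (WeakDual ℝ X)} (hS : IsCompact S) :
    ∃ M, ∀ f ∈ S, ‖WeakDual.toStrongDual f‖ ≤ M := by
  obtain ⟨M, hM⟩ := banach_steinhaus (g := fun i : S => WeakDual.toStrongDual i.val) fun x => by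
    obtain ⟨C, hC⟩ := hS.exists_bound_of_continuousOn (WeakDual.eval_continuous x).continuousOn
    exact ⟨C, fun i => hC i i.2⟩
  exact ⟨M, fun f hf => hM ⟨f, hf⟩⟩

lemma exists_forall_lt_of_countable (s : Set (Ordinal.omega.{0} 1).ToType) (hs : s.Countable) :
    ∃ b, ∀ a ∈ s, a < b := by
  have := hs.to_subtype
  have h : (⨆ a : s, Order.succ (Ordinal.ToType.mk.symm a.1).1) < Ordinal.omega.{0} 1 :=
    Ordinal.iSup_lt_omega_one fun a =>
      (Cardinal.isSuccLimit_omega 1).succ_lt (Ordinal.ToType.mk.symm a.1).2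
  refine ⟨Ordinal.ToType.mk ⟨_, h⟩, fun a ha => ?_⟩
  rw [← OrderIso.symm_apply_lt]
  have h1 : (Ordinal.ToType.mk.symm a).1 < ⨆ a : s, Order.succ (Ordinal.ToType.mk.symm a.1).1 :=
    (Order.lt_succ _).trans_le
      (Ordinal.le_iSup (fun a : s => Order.succ (Ordinal.ToType.mk.symm a.1).1) ⟨a, ha⟩)
  exact h1

section Quotient

variable {W : Type} [LinearOrder W]

/-- The map replacing each binary sequence by the number that it represents. -/
noncomputable def evalMap (W : Type) [LinearOrder W] (t : treeCompactum W) (y : Node W) : ℝ :=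
  binVal (t.1 y)

lemma continuous_evalMap : Continuous (evalMap W) :=
  continuous_pi fun y =>
    continuous_binVal.comp ((continuous_apply y).comp continuous_subtype_val)

open Classical in
/-- The point of the compactum with a given value at a node and vanishing elsewhere. -/
noncomputable def singlePoint (y : Node W) (s : ℕ → Bool) : treeCompactum W :=
  ⟨Function.update (fun _ _ => false) y s, single_mem_treeCompactum y s⟩

lemma singlePoint_self (y : Node W) (s : ℕ → Bool) : (singlePoint y s).1 y = s := by
  simp [singlePoint]

lemma singlePoint_of_ne {y z : Node W} (h : z ≠ y) (s : ℕ → Bool) :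
    (singlePoint y s).1 z = fun _ => false := by
  simp [singlePoint, h]

lemma evalMap_singlePoint_eq (y : Node W) {s s' : ℕ → Bool} (h : binVal s = binVal s') :
    evalMap W (singlePoint y s) = evalMap W (singlePoint y s') := by
  funext z
  by_cases hz : z = y
  · subst hz
    simpa [evalMap, singlePoint_self] using h
  · simp [evalMap, singlePoint_of_ne hz]

lemma evalMap_singlePoint_ne (y : Node W) :
    evalMap W (singlePoint y fun _ => true) ≠ evalMap W (singlePoint y fun _ => false) := by
  intro h
  have := congrFun h y
  simp [evalMap, singlePoint_self, binVal_const_true, binVal_const_false] at this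

/-- A continuous function on the compactum depends up to `ε` on finitely many coordinates,
near a given point. -/
lemma exists_finset_forall_abs_sub_lt {f : treeCompactum W → ℝ} (hf : Continuous f)
    (p : treeCompactum W) {ε : ℝ} (hε : 0 < ε) :
    ∃ E : Finset (Node W), ∀ t : treeCompactum W, (∀ z ∈ E, t.1 z = p.1 z) → |f t - f p| < ε := by
  have hU : f ⁻¹' Metric.ball (f p) ε ∈ nhds p :=
    hf.continuousAt (Metric.ball_mem_nhds _ hε)
  obtain ⟨V, hV, hVU⟩ := mem_nhds_subtype _ _ _ |>.1 hU
  rw [nhds_pi, Filter.mem_pi] at hV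
  obtain ⟨I, hI, u, hu, huV⟩ := hV
  refine ⟨hI.toFinset, fun t ht => ?_⟩
  have : t ∈ f ⁻¹' Metric.ball (f p) ε := hVU (huV fun z hz => by
    rw [ht z (hI.mem_toFinset.2 hz)]
    exact mem_of_mem_nhds (hu z))
  rwa [mem_preimage, Metric.mem_ball, Real.dist_eq] at this

theorem containsL1_of_weakDual_valued [WellFoundedLT W]
    (hW : ∀ s : Set W, s.Countable → ∃ b, ∀ a ∈ s, a < b)
    {X : Type*} [NormedAddCommGroup X] [NormedSpace ℝ X] [CompleteSpace X]
    {ψ : treeCompactum W → WeakDual ℝ X} (hψ : Continuous ψ)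
    {M : ℝ} (hM : ∀ t, ‖WeakDual.toStrongDual (ψ t)‖ ≤ M)
    (hev : ∀ t t', ψ t = ψ t' ↔ evalMap W t = evalMap W t') : ContainsL1 X := by
  have hx : ∀ y : Node W, ∃ x : X,
      ψ (singlePoint y fun _ => true) x - ψ (singlePoint y fun _ => false) x = 1 := by
    intro y
    have h := (hev _ _).not.2 (evalMap_singlePoint_ne y)
    obtain ⟨x, hx⟩ : ∃ x, ψ (singlePoint y fun _ => true) x ≠
        ψ (singlePoint y fun _ => false) x := by
      by_contra! hcon
      exact h (DFunLike.ext _ _ hcon)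
    have h0 := sub_ne_zero.2 hx
    refine ⟨(ψ (singlePoint y fun _ => true) x - ψ (singlePoint y fun _ => false) x)⁻¹ • x, ?_⟩
    rw [map_smul, map_smul, ← smul_sub, smul_eq_mul, inv_mul_cancel₀ h0]
  choose x hx using hx
  have hgap : ∀ (y : Node W) k, ∃ s : ℕ → Bool, 2⁻¹ ^ k ≤
      ψ (singlePoint y (word s k true)) (x y) - ψ (singlePoint y (word s k false)) (x y) := by
    intro y k
    refine exists_word_gap (g := fun s => ψ (singlePoint y s) (x y)) (fun s k => ?_)
      (hx y).ge k
    rw [(hev _ _).2 (evalMap_singlePoint_eq y (binVal_glue s k))]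
  choose s hs using hgap
  have hcont : ∀ v : X, Continuous fun t => ψ t v := fun v =>
    (WeakDual.eval_continuous v).comp hψ
  have hE : ∀ y b, ∃ E : Finset (Node W), ∀ t : treeCompactum W,
      (∀ z ∈ E, t.1 z = (singlePoint y (word (s y ⌈‖x y‖⌉₊) ⌈‖x y‖⌉₊ b)).1 z) →
        |ψ t (x y) - ψ (singlePoint y (word (s y ⌈‖x y‖⌉₊) ⌈‖x y‖⌉₊ b)) (x y)| <
          2⁻¹ ^ ⌈‖x y‖⌉₊ / 4 := fun y b =>
    exists_finset_forall_abs_sub_lt (hcont _) _ (by positivity)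
  choose E hE using hE
  classical
  obtain ⟨k, y, hc, hxe, hxn, hp, hEy⟩ := exists_homogeneous_sequence hW
    (fun y => ⌈‖x y‖⌉₊) fun y => E y true ∪ E y false
  have hom : IsHomogeneous k y :=
    ⟨hxe, hxn, fun n m h => (hp n m h).1, fun n m h => (hp n m h).2⟩
  obtain ⟨w, hw⟩ := Finite.exists_infinite_fiber fun n (j : Fin k) => s (y n) k j
  let φ := Nat.orderEmbeddingOfSet
    ((fun n (j : Fin k) => s (y n) k j) ⁻¹' {w})
  have hφ : ∀ m (j : ℕ), j < k → s (y (φ m)) k j = s (y (φ 0)) k j := fun m j hj => by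
    have h := fun m => (Nat.orderEmbeddingOfSet_range
      ((fun n (j : Fin k) => s (y n) k j) ⁻¹' {w})).le ⟨m, rfl⟩
    exact congrFun ((h m).trans (h 0).symm) ⟨j, hj⟩
  have hword : ∀ m b, word (s (y (φ m)) k) k b = word (s (y (φ 0)) k) k b := fun m b =>
    funext fun j => by
      simp only [word]
      split_ifs with hj
      · exact hφ m j hj
      · rfl
  let P : Set ℕ → treeCompactum W := fun B =>
    ⟨_, hom.extend_mem (T := fun n => word (s (y (φ 0)) k) k (decide (n ∈ φ '' B)))
      fun n m l hl => by simp only [word, if_pos hl]⟩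
  have hP : ∀ B m, |ψ (P B) (x (y (φ m))) - ψ (singlePoint (y (φ m))
      (word (s (y (φ m)) k) k (decide (m ∈ B)))) (x (y (φ m)))| < 2⁻¹ ^ k / 4 := by
    intro B m
    have h := hE (y (φ m)) (decide (m ∈ B)) (P B) fun z hz => ?_
    · rwa [hc] at h
    · rw [hc, hword]
      by_cases hzy : z = y (φ m)
      · subst hzy
        rw [singlePoint_self]
        simp only [P, hom.injective.extend_apply, φ.injective.mem_set_image]
      · rw [singlePoint_of_ne hzy]
        by_cases hzr : ∃ l, y l = z
        · obtain ⟨l, rfl⟩ := hzr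
          refine absurd ?_ (hEy (φ m) l fun h => hzy (by rw [h]))
          cases h : decide (m ∈ B) <;> rw [h] at hz <;> simp [hz]
        · simp only [P]
          exact Function.extend_apply' _ _ _ hzr
  refine containsL1_of_signs (x := fun m => x (y (φ m))) (C := k) (M := M + M)
    (δ := 2⁻¹ ^ k / 2) (fun m => (Nat.le_ceil _).trans (by rw [hc])) (by positivity)
    (F := fun B => WeakDual.toStrongDual (ψ (P B)) - WeakDual.toStrongDual (ψ (P Bᶜ)))
    (fun B => (norm_sub_le _ _).trans (add_le_add (hM _) (hM _))) (fun B m hm => ?_)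
    fun B m hm => ?_
  all_goals
    have h1 := abs_lt.1 (hP B m)
    have h2 := abs_lt.1 (hP Bᶜ m)
    have h3 := hs (y (φ m)) k
    simp only [mem_compl_iff, hm, not_true, not_false_iff, decide_true, decide_false] at h1 h2
    simp only [sub_apply, WeakDual.toStrongDual_apply]
    linarith

theorem not_isWRN_range_evalMap [WellFoundedLT W]
    (hW : ∀ s : Set W, s.Countable → ∃ b, ∀ a ∈ s, a < b) : ¬ IsWRN (range (evalMap W)) := by
  rintro ⟨X, _, _, _, S, hX, hS, ⟨e⟩⟩
  obtain ⟨M, hM⟩ := exists_norm_le_of_isCompact_weakDual hS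
  refine hX (containsL1_of_weakDual_valued hW (ψ := fun t => e (rangeFactorization (evalMap W) t))
    (continuous_subtype_val.comp (e.continuous.comp
      (continuous_evalMap.subtype_mk _))) (fun t => hM _ (Subtype.prop _)) fun t t' => ?_)
  rw [Subtype.val_inj, e.injective.eq_iff, ← Subtype.val_inj]
  rfl

end Quotient

/-- There are compact Hausdorff spaces `K` and `L` and a continuous surjection `π : K → L`
such that `K` is weakly Radon–Nikodým but `L` is not: the class of WRN compacta is not
stable under continuous images. -/
theorem exists_wrn_compact_with_non_wrn_continuous_image :
    ∃ (K L : Type) (tK : TopologicalSpace K) (tL : TopologicalSpace L),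
      @CompactSpace K tK ∧ @T2Space K tK ∧ @CompactSpace L tL ∧ @T2Space L tL ∧
      ∃ π : K → L, @Continuous K L tK tL π ∧ Function.Surjective π ∧
        @IsWRN K tK ∧ ¬ @IsWRN L tL := by
  have : Nonempty (Ordinal.omega.{0} 1).ToType :=
    ⟨(exists_forall_lt_of_countable ∅ countable_empty).choose⟩
  refine ⟨treeCompactum (Ordinal.omega.{0} 1).ToType, range (evalMap _), inferInstance,
    inferInstance, inferInstance, inferInstance,
    isCompact_iff_compactSpace.1 (isCompact_range continuous_evalMap), inferInstance,
    rangeFactorization (evalMap _), continuous_evalMap.subtype_mk _, rangeFactorization_surjective,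
    isWRN_treeCompactum, not_isWRN_range_evalMap exists_forall_lt_of_countable⟩
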